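/- Let 0 < a < b be real numbers and define the sequence (s_n) recursively by s₁ = a and s_{n+1} = 2 s_n − b. For a measurable function f : ℝ → ℂ write N_s(f) = ∫_ℝ |ξ|^{2s} |f(ξ)|² dξ. Then for every ε > 0, every n ≥ 1, and every measurable f for which N_b(f) and N_{s_{n+1}}(f) are finite, one has N_a(f) ≤ ε · (Σ_{m=0}^{n−1} 4^{−m}) · N_b(f) + 4^{−n} ε^{−(2ⁿ−1)} · N_{s_{n+1}}(f). -/

import Mathlib

open MeasureTheory

theorem gn_pointwise (b x ε : ℝ) (hx : 0 < x) (hε : 0 < ε)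
    (s : ℕ → ℝ) (hsrec : ∀ n, 1 ≤ n → s (n + 1) = 2 * s n - b) (n : ℕ) :
    x ^ (2 * s 1) ≤ (ε * ∑ m ∈ Finset.range n, ((4 : ℝ) ^ m)⁻¹) * x ^ (2 * b) +
      (((4 : ℝ) ^ n)⁻¹ * (ε ^ ((2 : ℝ) ^ n - 1))⁻¹) * x ^ (2 * s (n + 1)) := by
  induction n with
  | zero => simp
  | succ n ih =>
    refine ih.trans ?_
    have hpow : ∀ k : ℕ, ε ^ ((2 : ℝ) ^ k - 1) = ε ^ (2 ^ k) / ε := by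
      intro k
      rw [Real.rpow_sub hε, Real.rpow_one]
      congr 1
      rw [← Real.rpow_natCast ε (2 ^ k)]
      push_cast
      rfl
    rw [hpow, hpow, Finset.sum_range_succ, hsrec (n + 1) (by omega)]
    set t := s (n + 1)
    have h1 : x ^ (2 * b) = (x ^ b) ^ 2 := by
      rw [mul_comm, Real.rpow_mul hx.le]; norm_cast
    have h2 : x ^ (2 * t) = (x ^ t) ^ 2 := by
      rw [mul_comm, Real.rpow_mul hx.le]; norm_cast
    have h3 : x ^ (2 * (2 * t - b)) = ((x ^ t) ^ 2 / x ^ b) ^ 2 := by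
      rw [mul_comm, Real.rpow_mul hx.le, Real.rpow_sub hx, mul_comm 2 t, Real.rpow_mul hx.le]
      norm_cast
    rw [h1, h2, h3]
    have hB : 0 < x ^ b := Real.rpow_pos_of_pos hx _
    generalize x ^ b = B at *
    generalize x ^ t = T at *
    rw [pow_succ 2 n, pow_mul, pow_succ 4 n]
    have hE : 0 < ε ^ (2 ^ n) := by positivity
    generalize ε ^ (2 ^ n) = E at *
    have hF : (0 : ℝ) < 4 ^ n := by positivity
    generalize (4 : ℝ) ^ n = F at *
    generalize ∑ m ∈ Finset.range n, ((4 : ℝ) ^ m)⁻¹ = S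
    have key : 0 ≤ ε / F * (B - (T ^ 2 / B) / (2 * E)) ^ 2 := by positivity
    have e : ε * (S + F⁻¹) * B ^ 2 + (F * 4)⁻¹ * (E ^ 2 / ε)⁻¹ * (T ^ 2 / B) ^ 2
        - (ε * S * B ^ 2 + F⁻¹ * (E / ε)⁻¹ * T ^ 2)
        = ε / F * (B - (T ^ 2 / B) / (2 * E)) ^ 2 := by
      field_simp
      ring
    linarith

/-- Gagliardo–Nirenberg type inequality (Appendix Lemma A.1, first part), on the
Fourier side: with `N_s(f) = ∫ |ξ|^(2s) |f ξ|² dξ` and exponent sequence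
`s₁ = a`, `s_{n+1} = 2 s_n - b`, one has
`N_a(f) ≤ ε (∑_{m<n} 4^{-m}) N_b(f) + 4^{-n} ε^{-(2ⁿ-1)} N_{s_{n+1}}(f)`. -/
theorem gagliardo_nirenberg_iterated (a b : ℝ) (ha : 0 < a) (hab : a < b)
    (s : ℕ → ℝ) (hs1 : s 1 = a) (hsrec : ∀ n, 1 ≤ n → s (n + 1) = 2 * s n - b)
    (f : ℝ → ℂ) (hf : Measurable f) (n : ℕ) (hn : 1 ≤ n) (ε : ℝ) (hε : 0 < ε)
    (hNb : (∫⁻ ξ : ℝ, ENNReal.ofReal (|ξ| ^ (2 * b) * ‖f ξ‖ ^ 2)) ≠ ⊤)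
    (hNs : (∫⁻ ξ : ℝ, ENNReal.ofReal (|ξ| ^ (2 * s (n + 1)) * ‖f ξ‖ ^ 2)) ≠ ⊤) :
    (∫⁻ ξ : ℝ, ENNReal.ofReal (|ξ| ^ (2 * a) * ‖f ξ‖ ^ 2)) ≤
      ENNReal.ofReal (ε * ∑ m ∈ Finset.range n, ((4 : ℝ) ^ m)⁻¹) *
        (∫⁻ ξ : ℝ, ENNReal.ofReal (|ξ| ^ (2 * b) * ‖f ξ‖ ^ 2)) +
      ENNReal.ofReal (((4 : ℝ) ^ n)⁻¹ * (ε ^ ((2 : ℝ) ^ n - 1))⁻¹) *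
        (∫⁻ ξ : ℝ, ENNReal.ofReal (|ξ| ^ (2 * s (n + 1)) * ‖f ξ‖ ^ 2)) := by
  have hm : ∀ c : ℝ, Measurable fun ξ : ℝ => ENNReal.ofReal (|ξ| ^ c * ‖f ξ‖ ^ 2) := by
    intro c
    fun_prop
  rw [← lintegral_const_mul _ (hm _), ← lintegral_const_mul _ (hm _),
    ← lintegral_add_left ((hm _).const_mul _)]
  apply lintegral_mono_ae
  have h0 : ∀ᵐ ξ : ℝ, ξ ≠ 0 := by
    simp [ae_iff]
  filter_upwards [h0] with ξ hξ
  have hx : 0 < |ξ| := abs_pos.mpr hξ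
  have hS : 0 ≤ ε * ∑ m ∈ Finset.range n, ((4 : ℝ) ^ m)⁻¹ := by positivity
  have hC : 0 ≤ ((4 : ℝ) ^ n)⁻¹ * (ε ^ ((2 : ℝ) ^ n - 1))⁻¹ := by positivity
  rw [← ENNReal.ofReal_mul hS, ← ENNReal.ofReal_mul hC,
    ← ENNReal.ofReal_add (by positivity) (by positivity)]
  apply ENNReal.ofReal_le_ofReal
  have h := mul_le_mul_of_nonneg_right (gn_pointwise b |ξ| ε hx hε s hsrec n)
    (sq_nonneg ‖f ξ‖)
  rw [hs1] at h
  linarith
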